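/- arXiv:1201.0554 — 3 statements merged into one kernel-verified Lean document; each statement's English description precedes it below -/
import Mathlib

section
/- Let m be the largest order of a splittable (J₇, K₃)-good graph; that is, suppose there exists a splittable (J₇, K₃; m)-good graph and no splittable (J₇, K₃; n)-good graph exists for any n > m. Then R(K₃, K₃, K₄−e) = m + 1. -/
open SimpleGraph

/-- `G` contains a subgraph isomorphic to `H`:
there is an injective map from the vertices of `H` to those of `G` preserving adjacency. -/
def Contains {V W : Type*} (G : SimpleGraph V) (H : SimpleGraph W) : Prop :=
  ∃ f : W → V, Function.Injective f ∧ ∀ ⦃a b : W⦄, H.Adj a b → G.Adj (f a) (f b)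

/-- The triangle `K₃`. -/
def triangle : SimpleGraph (Fin 3) := ⊤

/-- The paw graph `K₃ + e`: a triangle `{0, 1, 2}` with a pendant edge `{2, 3}`. -/
def paw : SimpleGraph (Fin 4) :=
  SimpleGraph.fromEdgeSet {s(0, 1), s(0, 2), s(1, 2), s(2, 3)}

/-- `J₄ = K₄ - e`, the complete graph on 4 vertices with one edge deleted. -/
def J4 : SimpleGraph (Fin 4) := (⊤ : SimpleGraph (Fin 4)).deleteEdges {s(0, 1)}

/-- The graph formed by the edges of color `i` in the edge coloring `c` of `K_n`. -/
def colorClass {n m : ℕ} (c : Sym2 (Fin n) → Fin m) (i : Fin m) : SimpleGraph (Fin n) :=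
  SimpleGraph.fromEdgeSet {e | c e = i}

/-- `J₇ = K₇ - e`, the complete graph on 7 vertices with one edge deleted. -/
def J7 : SimpleGraph (Fin 7) := (⊤ : SimpleGraph (Fin 7)).deleteEdges {s(0, 1)}

/-- A `(G1, G2, G3; n)`-coloring: a 3-coloring of the edges of `K_n` such that
color `i` contains no subgraph isomorphic to `Gi`. -/
def GoodColoring3 {a b d : ℕ} (G1 : SimpleGraph (Fin a)) (G2 : SimpleGraph (Fin b))
    (G3 : SimpleGraph (Fin d)) (n : ℕ) : Prop :=
  ∃ c : Sym2 (Fin n) → Fin 3,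
    ¬ Contains (colorClass c 0) G1 ∧ ¬ Contains (colorClass c 1) G2 ∧
      ¬ Contains (colorClass c 2) G3

/-- The 3-color Ramsey number `R(G1, G2, G3)`:
the least `n` such that no `(G1, G2, G3; n)`-coloring exists. -/
noncomputable def Ramsey3 {a b d : ℕ} (G1 : SimpleGraph (Fin a)) (G2 : SimpleGraph (Fin b))
    (G3 : SimpleGraph (Fin d)) : ℕ :=
  sInf {n : ℕ | ¬ GoodColoring3 G1 G2 G3 n}

/-- A graph `G` is splittable if its edges can be partitioned into two classes,
the first containing no triangle `K₃` and the second containing no `K₄ - e`. -/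
def Splittable {n : ℕ} (G : SimpleGraph (Fin n)) : Prop :=
  ∃ H : SimpleGraph (Fin n), H ≤ G ∧ ¬ Contains H triangle ∧ ¬ Contains (G \ H) J4

/-- `G` is a `(G1, G2)`-good graph: `G` contains no subgraph isomorphic to `G1` and
its complement contains no subgraph isomorphic to `G2`. -/
def IsGoodGraph {a b n : ℕ} (G1 : SimpleGraph (Fin a)) (G2 : SimpleGraph (Fin b))
    (G : SimpleGraph (Fin n)) : Prop :=
  ¬ Contains G G1 ∧ ¬ Contains Gᶜ G2

section Arrowing

variable {V : Type*} {H K : SimpleGraph V}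

/-- Five distinct vertices joined completely, with `z` joined to all of them in `H ∪ K` and to four
of them in `K`, cannot avoid both a triangle in `H` and a `K₄ - e` in `K`. -/
lemma not_four_right_neighbors
    (hH : ∀ a b c, H.Adj a b → H.Adj b c → H.Adj a c → False)
    (hK : ∀ a b c d, K.Adj a b → K.Adj a c → K.Adj b c → K.Adj a d → K.Adj b d → c = d)
    {z a b c d e : V} (nd : [a, b, c, d, e].Nodup)
    (h : ∀ x ∈ [a, b, c, d, e], ∀ y ∈ [a, b, c, d, e], x ≠ y → H.Adj x y ∨ K.Adj x y)
    (hz : ∀ x ∈ [a, b, c, d, e], H.Adj z x ∨ K.Adj z x)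
    (ha : K.Adj z a) (hb : K.Adj z b) (hc : K.Adj z c) : ¬ K.Adj z d := by
  simp only [List.nodup_cons, List.mem_cons, List.not_mem_nil, or_false, not_or,
    List.nodup_nil, forall_eq_or_imp, forall_eq] at nd h hz
  have s := H.adj_comm
  have t := K.adj_comm
  grind (splits := 30) (instances := 20000) (ematch := 20)

/-- If `{z, a, b}` is a triangle of `K` and `z` is joined to `c` in `K` and to `d` in `H`, then
`c` and `d` are joined in `K`. -/
lemma right_adj_of_right_triangle
    (hH : ∀ a b c, H.Adj a b → H.Adj b c → H.Adj a c → False)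
    (hK : ∀ a b c d, K.Adj a b → K.Adj a c → K.Adj b c → K.Adj a d → K.Adj b d → c = d)
    {z a b c d : V} (hac : a ≠ c) (hbc : b ≠ c)
    (eac : H.Adj a c ∨ K.Adj a c) (ebc : H.Adj b c ∨ K.Adj b c) (ead : H.Adj a d ∨ K.Adj a d)
    (ebd : H.Adj b d ∨ K.Adj b d) (ecd : H.Adj c d ∨ K.Adj c d)
    (kza : K.Adj z a) (kzb : K.Adj z b) (kzc : K.Adj z c) (kab : K.Adj a b) (hzd : H.Adj z d) :
    K.Adj c d := by
  have hac' : H.Adj a c := eac.resolve_right fun h => hbc (hK z a b c kza kzb kab kzc h)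
  have hbc' : H.Adj b c := ebc.resolve_right fun h => hac (hK z b a c kzb kza kab.symm kzc h)
  refine ecd.resolve_left fun hcd => hzd.ne (hK a b z d kab kza.symm kzb.symm ?_ ?_)
  · exact ead.resolve_left fun h => hH a c d hac' hcd h
  · exact ebd.resolve_left fun h => hH b c d hbc' hcd h

lemma adj_of_mem_triangle {x y a b c : V} (kab : K.Adj a b) (kac : K.Adj a c) (kbc : K.Adj b c)
    (hx : x = a ∨ x = b ∨ x = c) (hy : y = a ∨ y = b ∨ y = c) (hxy : x ≠ y) : K.Adj x y := by
  rcases hx with rfl | rfl | rfl <;> rcases hy with rfl | rfl | rfl <;>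
    simp_all [K.adj_comm]

lemma exists_three_same_color [DecidableEq V] {S : Finset V} (hS : S.card = 5) {z : V}
    (hz : ∀ x ∈ S, H.Adj z x ∨ K.Adj z x) :
    ∃ a b c d e, [a, b, c, d, e].Nodup ∧ S = {a, b, c, d, e} ∧
      ((H.Adj z a ∧ H.Adj z b ∧ H.Adj z c) ∨ (K.Adj z a ∧ K.Adj z b ∧ K.Adj z c)) := by
  classical
  have hsplit := Finset.card_filter_add_card_filter_not (s := S) (fun x => K.Adj z x)
  have hT : ∃ T ⊆ S, T.card = 3 ∧ ((∀ x ∈ T, H.Adj z x) ∨ ∀ x ∈ T, K.Adj z x) := by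
    by_cases h3 : 3 ≤ (S.filter fun x => K.Adj z x).card
    · obtain ⟨T, hT, hc⟩ := Finset.exists_subset_card_eq h3
      exact ⟨T, hT.trans (Finset.filter_subset _ _), hc,
        Or.inr fun x hx => (Finset.mem_filter.1 (hT hx)).2⟩
    · obtain ⟨T, hT, hc⟩ := Finset.exists_subset_card_eq
        (show 3 ≤ (S.filter fun x => ¬ K.Adj z x).card by omega)
      refine ⟨T, hT.trans (Finset.filter_subset _ _), hc, Or.inl fun x hx => ?_⟩
      have hx' := Finset.mem_filter.1 (hT hx)
      exact (hz x hx'.1).resolve_right hx'.2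
  obtain ⟨T, hTS, hT3, hT⟩ := hT
  have hrest : (S \ T).card = 2 := by
    rw [Finset.card_sdiff_of_subset hTS]; omega
  obtain ⟨a, b, c, hab, hac, hbc, rfl⟩ := Finset.card_eq_three.1 hT3
  obtain ⟨d, e, hde, hR⟩ := Finset.card_eq_two.1 hrest
  have hd : d ∈ S \ {a, b, c} := by simp [hR]
  have he : e ∈ S \ {a, b, c} := by simp [hR]
  refine ⟨a, b, c, d, e, ?_, ?_, ?_⟩
  · simp only [Finset.mem_sdiff, Finset.mem_insert, Finset.mem_singleton] at hd he
    simp only [List.nodup_cons, List.mem_cons, List.not_mem_nil, or_false, not_or,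
      List.nodup_nil]
    grind
  · rw [← Finset.union_sdiff_of_subset hTS, hR]
    ext x
    simp only [Finset.mem_union, Finset.mem_insert, Finset.mem_singleton, or_assoc]
  · simpa using hT

lemma right_adj_of_disjoint_right_triangle
    (hH : ∀ a b c, H.Adj a b → H.Adj b c → H.Adj a c → False)
    (hK : ∀ a b c d, K.Adj a b → K.Adj a c → K.Adj b c → K.Adj a d → K.Adj b d → c = d)
    {a b c d e : V} (nad : a ≠ d) (nbd : b ≠ d) (ncd : c ≠ d) (nae : a ≠ e) (nbe : b ≠ e)
    (nce : c ≠ e) (kab : K.Adj a b) (kac : K.Adj a c) (kbc : K.Adj b c)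
    (ead : H.Adj a d ∨ K.Adj a d) (ebd : H.Adj b d ∨ K.Adj b d) (ecd : H.Adj c d ∨ K.Adj c d)
    (eae : H.Adj a e ∨ K.Adj a e) (ebe : H.Adj b e ∨ K.Adj b e) (ece : H.Adj c e ∨ K.Adj c e)
    (ede : H.Adj d e ∨ K.Adj d e) : K.Adj d e := by
  refine ede.resolve_left fun hde => ?_
  have left : ∀ x, H.Adj x d → ¬ H.Adj x e := fun x h h' => hH x d e h hde h'
  have right : ∀ x, a ≠ x → b ≠ x → c ≠ x → ¬ (K.Adj a x ∧ K.Adj b x) ∧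
      ¬ (K.Adj a x ∧ K.Adj c x) ∧ ¬ (K.Adj b x ∧ K.Adj c x) := fun x hax hbx hcx =>
    ⟨fun h => hcx (hK a b c x kab kac kbc h.1 h.2),
      fun h => hbx (hK a c b x kac kab kbc.symm h.1 h.2),
      fun h => hax (hK b c a x kbc kab.symm kac.symm h.1 h.2)⟩
  have hd := right d nad nbd ncd
  have he := right e nae nbe nce
  have ha := left a
  have hb := left b
  have hc := left c
  clear hH hK left right
  grind

/-- In a splitting of `K₆` into a triangle-free `H` and a `K₄ - e`-free `K`, the vertices are
covered by two disjoint triangles of `K`. -/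
lemma exists_right_triangles [DecidableEq V]
    (hH : ∀ a b c, H.Adj a b → H.Adj b c → H.Adj a c → False)
    (hK : ∀ a b c d, K.Adj a b → K.Adj a c → K.Adj b c → K.Adj a d → K.Adj b d → c = d)
    {S : Finset V} (hS : S.card = 5)
    (h : ∀ x ∈ S, ∀ y ∈ S, x ≠ y → H.Adj x y ∨ K.Adj x y)
    {z : V} (hz : ∀ x ∈ S, H.Adj z x ∨ K.Adj z x) :
    ∃ p ∈ S, ∃ q ∈ S, K.Adj z p ∧ K.Adj z q ∧ K.Adj p q ∧
      ∀ x ∈ S, ∀ y ∈ S, x ≠ p → x ≠ q → y ≠ p → y ≠ q → x ≠ y → K.Adj x y := by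
  obtain ⟨a, b, c, d, e, nd, rfl, hT⟩ := exists_three_same_color hS hz
  have hl : ∀ x, x ∈ ({a, b, c, d, e} : Finset V) ↔ x ∈ [a, b, c, d, e] := by simp
  simp only [hl] at h hz ⊢
  clear hl hS
  have nd' := nd
  have h' := h
  have hz' := hz
  simp only [List.nodup_cons, List.mem_cons, List.not_mem_nil, or_false, not_or,
    List.nodup_nil, not_false_eq_true, and_true] at nd'
  obtain ⟨⟨nab, nac, nad, nae⟩, ⟨nbc, nbd, nbe⟩, ⟨ncd, nce⟩, nde⟩ := nd'
  simp only [List.mem_cons, List.not_mem_nil, or_false, forall_eq_or_imp, forall_eq, ne_eq,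
    not_true_eq_false, false_imp_iff, true_and, and_true, nab, nac, nad, nae, nbc, nbd, nbe, ncd,
    nce, nde, not_false_eq_true, forall_const] at h' hz'
  obtain ⟨⟨eab, eac, ead, eae⟩, ⟨-, ebc, ebd, ebe⟩, ⟨-, -, ecd, ece⟩, ⟨-, -, -, ede⟩, -⟩ := h'
  obtain ⟨-, -, -, hzd, hze⟩ := hz'
  rcases hT with ⟨ha, hb, hc⟩ | ⟨ha, hb, hc⟩
  · have kab : K.Adj a b := eab.resolve_left fun h => hH z a b ha h hb
    have kac : K.Adj a c := eac.resolve_left fun h => hH z a c ha h hc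
    have kbc : K.Adj b c := ebc.resolve_left fun h => hH z b c hb h hc
    have hd : K.Adj z d := hzd.resolve_left fun hd => ncd (hK a b c d kab kac kbc
      (ead.resolve_left fun h => hH z a d ha h hd) (ebd.resolve_left fun h => hH z b d hb h hd))
    have he : K.Adj z e := hze.resolve_left fun he => nce (hK a b c e kab kac kbc
      (eae.resolve_left fun h => hH z a e ha h he) (ebe.resolve_left fun h => hH z b e hb h he))
    have kde : K.Adj d e := right_adj_of_disjoint_right_triangle hH hK nad nbd ncd nae nbe nce
      kab kac kbc ead ebd ecd eae ebe ece ede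
    refine ⟨d, by simp, e, by simp, hd, he, kde, ?_⟩
    exact fun x hx y hy hxp hxq hyp hyq => adj_of_mem_triangle kab kac kbc
      (by simpa [hxp, hxq] using hx) (by simpa [hyp, hyq] using hy)
  · have hd : H.Adj z d := hzd.resolve_right (not_four_right_neighbors hH hK nd h hz ha hb hc)
    have hperm : [a, b, c, d, e].Perm [a, b, c, e, d] :=
      (((List.Perm.swap e d []).cons c).cons b).cons a
    have he : H.Adj z e := hze.resolve_right (not_four_right_neighbors hH hK (hperm.nodup nd)
      (fun x hx y hy => h x (hperm.mem_iff.2 hx) y (hperm.mem_iff.2 hy))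
      (fun x hx => hz x (hperm.mem_iff.2 hx)) ha hb hc)
    have kde : K.Adj d e := ede.resolve_left fun h => hH z d e hd h he
    have hp : K.Adj a b ∨ K.Adj a c ∨ K.Adj b c := by
      by_contra! hp
      exact hH a b c (eab.resolve_right hp.1) (ebc.resolve_right hp.2.2) (eac.resolve_right hp.2.1)
    rcases hp with hp | hp | hp
    · have kcd : K.Adj c d := right_adj_of_right_triangle hH hK nac nbc
        eac ebc
        ead ebd ecd ha hb hc hp hd
      have kce : K.Adj c e := right_adj_of_right_triangle hH hK nac nbc
        eac ebc
        eae ebe ece ha hb hc hp he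
      refine ⟨a, by simp, b, by simp, ha, hb, hp, ?_⟩
      exact fun x hx y hy hxp hxq hyp hyq => adj_of_mem_triangle kcd kce kde
        (by simpa [hxp, hxq] using hx) (by simpa [hyp, hyq] using hy)
    · have kbd : K.Adj b d := right_adj_of_right_triangle hH hK nab (Ne.symm nbc)
        eab (ebc.imp SimpleGraph.Adj.symm SimpleGraph.Adj.symm)
        ead ecd ebd ha hc hb hp hd
      have kbe : K.Adj b e := right_adj_of_right_triangle hH hK nab (Ne.symm nbc)
        eab (ebc.imp SimpleGraph.Adj.symm SimpleGraph.Adj.symm)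
        eae ece ebe ha hc hb hp he
      refine ⟨a, by simp, c, by simp, ha, hc, hp, ?_⟩
      exact fun x hx y hy hxp hxq hyp hyq => adj_of_mem_triangle kbd kbe kde
        (by simpa [hxp, hxq] using hx) (by simpa [hyp, hyq] using hy)
    · have kad : K.Adj a d := right_adj_of_right_triangle hH hK (Ne.symm nab) (Ne.symm nac)
        (eab.imp SimpleGraph.Adj.symm SimpleGraph.Adj.symm) (eac.imp SimpleGraph.Adj.symm SimpleGraph.Adj.symm)
        ebd ecd ead hb hc ha hp hd
      have kae : K.Adj a e := right_adj_of_right_triangle hH hK (Ne.symm nab) (Ne.symm nac)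
        (eab.imp SimpleGraph.Adj.symm SimpleGraph.Adj.symm) (eac.imp SimpleGraph.Adj.symm SimpleGraph.Adj.symm)
        ebe ece eae hb hc ha hp he
      refine ⟨b, by simp, c, by simp, hb, hc, hp, ?_⟩
      exact fun x hx y hy hxp hxq hyp hyq => adj_of_mem_triangle kad kae kde
        (by simpa [hxp, hxq] using hx) (by simpa [hyp, hyq] using hy)

/-- `J₇` arrows `(K₃, K₄ - e)`: the vertices `z` and `z'` are the ends of the missing edge. -/
lemma not_split_of_two_apexes
    (hH : ∀ a b c, H.Adj a b → H.Adj b c → H.Adj a c → False)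
    (hK : ∀ a b c d, K.Adj a b → K.Adj a c → K.Adj b c → K.Adj a d → K.Adj b d → c = d)
    {S : Finset V} (hS : S.card = 5)
    (h : ∀ x ∈ S, ∀ y ∈ S, x ≠ y → H.Adj x y ∨ K.Adj x y)
    {z z' : V} (hne : z ≠ z') (hz'S : z' ∉ S)
    (hz : ∀ x ∈ S, H.Adj z x ∨ K.Adj z x) (hz' : ∀ x ∈ S, H.Adj z' x ∨ K.Adj z' x) : False := by
  classical
  obtain ⟨p, hp, q, hq, zp, zq, pq, hT⟩ := exists_right_triangles hH hK hS h hz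
  obtain ⟨p', hp', q', hq', zp', zq', pq', hT'⟩ := exists_right_triangles hH hK hS h hz'
  have s := K.adj_comm
  have shared : ∀ r, ∃ x ∈ S, ∃ y ∈ S, x ≠ y ∧ x ∉ ({p, q, r} : Finset V) ∧
      y ∉ ({p, q, r} : Finset V) := by
    intro r
    have h2 : 1 < (S \ {p, q, r}).card := by
      have := Finset.le_card_sdiff {p, q, r} S
      have := Finset.card_le_three (a := p) (b := q) (c := r)
      omega
    obtain ⟨x, hx, y, hy, hxy⟩ := Finset.one_lt_card.1 h2
    rw [Finset.mem_sdiff] at hx hy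
    exact ⟨x, hx.1, y, hy.1, hxy, hx.2, hy.2⟩
  have hpq := pq.ne
  have hpq' := pq'.ne
  by_cases h1 : p' = p ∨ p' = q
  · by_cases h2 : q' = p ∨ q' = q
    · exact hne (hK p q z z' pq zp.symm zq.symm (by grind) (by grind))
    · obtain ⟨x, hx, y, hy, hxy, hxn, hyn⟩ := shared q'
      simp only [Finset.mem_insert, Finset.mem_singleton, not_or] at hxn hyn
      obtain ⟨r, hr, hrp, hrq', hrpq, hrq⟩ : ∃ r ∈ S, r ≠ p' ∧ r ≠ q' ∧ (r = p ∨ r = q) ∧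
          r ≠ q' := by grind
      refine hrq (hK x y r q' (hT x hx y hy ?_ ?_ ?_ ?_ hxy) (hT' x hx r hr ?_ ?_ ?_ ?_ ?_)
        (hT' y hy r hr ?_ ?_ ?_ ?_ ?_) (hT x hx q' hq' ?_ ?_ ?_ ?_ ?_)
        (hT y hy q' hq' ?_ ?_ ?_ ?_ ?_)) <;> grind
  · by_cases h2 : q' = p ∨ q' = q
    · obtain ⟨x, hx, y, hy, hxy, hxn, hyn⟩ := shared p'
      simp only [Finset.mem_insert, Finset.mem_singleton, not_or] at hxn hyn
      obtain ⟨r, hr, hrp, hrq', hrpq, hrq⟩ : ∃ r ∈ S, r ≠ p' ∧ r ≠ q' ∧ (r = p ∨ r = q) ∧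
          r ≠ p' := by grind
      refine hrq (hK x y r p' (hT x hx y hy ?_ ?_ ?_ ?_ hxy) (hT' x hx r hr ?_ ?_ ?_ ?_ ?_)
        (hT' y hy r hr ?_ ?_ ?_ ?_ ?_) (hT x hx p' hp' ?_ ?_ ?_ ?_ ?_)
        (hT y hy p' hp' ?_ ?_ ?_ ?_ ?_)) <;> grind
    · obtain ⟨x, hx, y, hy, hxy, hxn, hyn⟩ := shared p'
      simp only [Finset.mem_insert, Finset.mem_singleton, not_or] at hxn hyn
      obtain ⟨t, ht, htp, htq, htp', htq'⟩ : ∃ t ∈ S, t ≠ p ∧ t ≠ q ∧ t ≠ p' ∧ t ≠ q' := by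
        by_cases hx' : x = q'
        · exact ⟨y, hy, hyn.1, hyn.2.1, hyn.2.2, fun hy' => hxy (hx'.trans hy'.symm)⟩
        · exact ⟨x, hx, hxn.1, hxn.2.1, hxn.2.2, hx'⟩
      have htz : t = z' := hK p' q' t z' pq'
        (hT p' hp' t ht (by grind) (by grind) htp htq htp'.symm)
        (hT q' hq' t ht (by grind) (by grind) htp htq htq'.symm) zp'.symm zq'.symm
      exact hz'S (htz ▸ ht)

end Arrowing

section Containment

variable {V W U : Type*} {G G' : SimpleGraph V}

lemma Contains.mono {X : SimpleGraph W} (h : Contains G X) (hle : G ≤ G') : Contains G' X := by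
  obtain ⟨f, hf, hadj⟩ := h
  exact ⟨f, hf, fun a b hab => hle (hadj hab)⟩

lemma contains_of_contains_comap {X : SimpleGraph W} {f : U → V} (hf : Function.Injective f)
    (h : Contains (G.comap f) X) : Contains G X := by
  obtain ⟨g, hg, hadj⟩ := h
  exact ⟨f ∘ g, hf.comp hg, fun a b hab => hadj hab⟩

lemma contains_triangle {a b c : V} (hab : G.Adj a b) (hbc : G.Adj b c) (hac : G.Adj a c) :
    Contains G triangle := by
  have h1 := hab.ne
  have h2 := hbc.ne
  have h3 := hac.ne
  refine ⟨![a, b, c], ?_, ?_⟩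
  · intro i j hij
    fin_cases i <;> fin_cases j <;> simp_all
  · intro i j hij
    fin_cases i <;> fin_cases j <;> simp_all [triangle, G.adj_comm]

lemma contains_J4 {a b c d : V} (hab : G.Adj a b) (hac : G.Adj a c) (hbc : G.Adj b c)
    (had : G.Adj a d) (hbd : G.Adj b d) (hcd : c ≠ d) : Contains G J4 := by
  have h1 := hab.ne
  have h2 := hac.ne
  have h3 := hbc.ne
  have h4 := had.ne
  have h5 := hbd.ne
  refine ⟨![c, d, a, b], ?_, ?_⟩
  · intro i j hij
    fin_cases i <;> fin_cases j <;> simp_all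
  · intro i j hij
    fin_cases i <;> fin_cases j <;> simp_all [J4, G.adj_comm]

lemma not_contains_J7_of_splitting {H : SimpleGraph V} (hH : ¬ Contains H triangle)
    (hK : ¬ Contains (G \ H) J4) : ¬ Contains G J7 := by
  rintro ⟨f, hf, hadj⟩
  have hsplit : ∀ i j : Fin 7, J7.Adj i j →
      (H.comap f).Adj i j ∨ ((G \ H).comap f).Adj i j := by
    intro i j hij
    have := hadj hij
    simp only [SimpleGraph.comap_adj, SimpleGraph.sdiff_adj]
    tauto
  refine not_split_of_two_apexes (H := H.comap f) (K := (G \ H).comap f)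
    (S := {2, 3, 4, 5, 6}) (z := 0) (z' := 1)
    (fun a b c h1 h2 h3 => hH (contains_of_contains_comap hf (contains_triangle h1 h2 h3)))
    (fun a b c d h1 h2 h3 h4 h5 => ?_) (by decide) (fun x hx y hy hxy => hsplit x y ?_)
    (by decide) (by decide) (fun x hx => hsplit 0 x ?_) (fun x hx => hsplit 1 x ?_)
  · by_contra hcd
    exact hK (contains_of_contains_comap hf (contains_J4 h1 h2 h3 h4 h5 hcd))
  all_goals
    simp only [J7, SimpleGraph.deleteEdges_adj, SimpleGraph.top_adj, Set.mem_singleton_iff]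
  · revert x y; decide
  · revert x; decide
  · revert x; decide

end Containment

lemma colorClass_adj {n m : ℕ} {c : Sym2 (Fin n) → Fin m} {i : Fin m} {a b : Fin n} :
    (colorClass c i).Adj a b ↔ c s(a, b) = i ∧ a ≠ b := by
  simp [colorClass]

lemma GoodColoring3.of_le {a b d : ℕ} {G1 : SimpleGraph (Fin a)} {G2 : SimpleGraph (Fin b)}
    {G3 : SimpleGraph (Fin d)} {n k : ℕ} (h : GoodColoring3 G1 G2 G3 n) (hkn : k ≤ n) :
    GoodColoring3 G1 G2 G3 k := by
  obtain ⟨c, h0, h1, h2⟩ := h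
  have hinj := Fin.castLE_injective hkn
  have hle : ∀ i, colorClass (c ∘ Sym2.map (Fin.castLE hkn)) i ≤
      (colorClass c i).comap (Fin.castLE hkn) := by
    intro i u v huv
    rw [colorClass_adj] at huv
    rw [SimpleGraph.comap_adj, colorClass_adj]
    exact ⟨huv.1, hinj.ne huv.2⟩
  exact ⟨c ∘ Sym2.map (Fin.castLE hkn),
    fun h => h0 (contains_of_contains_comap hinj (h.mono (hle 0))),
    fun h => h1 (contains_of_contains_comap hinj (h.mono (hle 1))),
    fun h => h2 (contains_of_contains_comap hinj (h.mono (hle 2)))⟩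

/-- A `(K₃, K₃, K₄ - e; n)`-coloring is the same as a splittable `(J₇, K₃; n)`-good graph. -/
lemma goodColoring3_iff_exists_splittable {n : ℕ} :
    GoodColoring3 triangle triangle J4 n ↔
      ∃ G : SimpleGraph (Fin n), IsGoodGraph J7 triangle G ∧ Splittable G := by
  classical
  constructor
  · rintro ⟨c, h0, h1, h2⟩
    have hle : colorClass c 1 ≤ (colorClass c 0)ᶜ := by
      intro u v huv
      rw [colorClass_adj] at huv
      rw [SimpleGraph.compl_adj, colorClass_adj]
      exact ⟨huv.2, fun h => by simp [huv.1] at h⟩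
    have hsdiff : (colorClass c 0)ᶜ \ colorClass c 1 ≤ colorClass c 2 := by
      intro u v huv
      rw [SimpleGraph.sdiff_adj, SimpleGraph.compl_adj, colorClass_adj, colorClass_adj] at huv
      rw [colorClass_adj]
      refine ⟨?_, huv.1.1⟩
      have := huv.1.2
      have := huv.2
      generalize c s(u, v) = i at *
      fin_cases i <;> simp_all
    have hJ4 : ¬ Contains ((colorClass c 0)ᶜ \ colorClass c 1) J4 := fun h => h2 (h.mono hsdiff)
    exact ⟨(colorClass c 0)ᶜ, ⟨not_contains_J7_of_splitting h1 hJ4, by rwa [compl_compl]⟩,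
      colorClass c 1, hle, h1, hJ4⟩
  · rintro ⟨G, ⟨-, hG⟩, H, hHG, hH, hJ4⟩
    refine ⟨fun e => if e ∈ H.edgeSet then 1 else if e ∈ G.edgeSet then 2 else 0,
      fun h => hG (h.mono ?_), fun h => hH (h.mono ?_), fun h => hJ4 (h.mono ?_)⟩ <;>
    · intro u v huv
      rw [colorClass_adj] at huv
      simp only [SimpleGraph.mem_edgeSet, SimpleGraph.compl_adj, SimpleGraph.sdiff_adj] at huv ⊢
      grind

/-- If `m` is the largest order of a splittable `(J₇, K₃)`-good graph, then
`R(K₃, K₃, K₄-e) = m + 1`. -/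
theorem ramsey_K3_K3_J4_eq_max_splittable_order_succ (m : ℕ)
    (hex : ∃ G : SimpleGraph (Fin m), IsGoodGraph J7 triangle G ∧ Splittable G)
    (hmax : ∀ n : ℕ, m < n → ∀ G : SimpleGraph (Fin n),
      IsGoodGraph J7 triangle G → ¬ Splittable G) :
    Ramsey3 triangle triangle J4 = m + 1 := by
  have hlt : ∀ k, m < k → ¬ GoodColoring3 triangle triangle J4 k := fun k hk h => by
    obtain ⟨G, hG, hs⟩ := goodColoring3_iff_exists_splittable.1 h
    exact hmax k hk G hG hs
  refine le_antisymm (Nat.sInf_le (hlt _ m.lt_succ_self)) (le_csInf ⟨_, hlt _ m.lt_succ_self⟩ ?_)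
  intro k hk
  by_contra hkm
  exact hk ((goodColoring3_iff_exists_splittable.2 hex).of_le (by omega))
end

section
/- R(K₃, K₄−e, K₄−e) ≥ 21. That is, there exists an assignment of one of 3 colors to the edges of the complete graph K₂₀ such that color 1 contains no triangle K₃ and colors 2 and 3 contain no subgraph isomorphic to K₄−e. -/
open SimpleGraph

/-- Finite Ramsey theorem for edge colorings, in asymmetric form: every large enough finite set
contains, for some color `i`, a subset of size `k i` all of whose pairs have color `i`. -/
theorem exists_card_forces_monochromatic {m : ℕ} (k : Fin m → ℕ) :
    ∃ N : ℕ, ∀ (V : Type) (c : Sym2 V → Fin m) (S : Finset V), N ≤ S.card →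
      ∃ i, ∃ T ⊆ S, T.card = k i ∧ (T : Set V).Pairwise fun a b => c s(a, b) = i := by
  classical
  induction hs : ∑ i, k i generalizing k with
  | zero =>
    refine ⟨1, fun V c S hS => ?_⟩
    obtain ⟨v, -⟩ := Finset.card_pos.mp hS
    exact ⟨c s(v, v), ∅, by simp, by simp_all, by simp⟩
  | succ s ih =>
    by_cases hk : ∃ i, k i = 0
    · obtain ⟨i, hi⟩ := hk
      exact ⟨0, fun V c S _ => ⟨i, ∅, by simp, by simp [hi], by simp⟩⟩
    push Not at hk
    have hsum : ∀ i, ∑ j, Function.update k i (k i - 1) j = s := by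
      intro i
      have h₁ := Finset.sum_update_of_mem (Finset.mem_univ i) k (k i - 1)
      have h₂ := Finset.add_sum_erase Finset.univ k (Finset.mem_univ i)
      have h₃ := hk i
      rw [Finset.sdiff_singleton_eq_erase] at h₁
      omega
    choose N hN using fun i => ih _ (hsum i)
    refine ⟨1 + ∑ i, N i, fun V c S hS => ?_⟩
    obtain ⟨v, hv⟩ := Finset.card_pos.mp (by omega : 0 < S.card)
    obtain ⟨i, hi⟩ : ∃ i, N i ≤ ((S.erase v).filter fun w => c s(v, w) = i).card := by
      by_contra! h
      have hlt := Finset.sum_lt_sum_of_nonempty ⟨c s(v, v), Finset.mem_univ _⟩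
        fun i (_ : i ∈ Finset.univ) => h i
      rw [← Finset.card_eq_sum_card_fiberwise fun _ _ => Finset.mem_coe.mpr (Finset.mem_univ _),
        Finset.card_erase_of_mem hv] at hlt
      omega
    obtain ⟨j, T, hTS, hcard, hT⟩ := hN i V c _ hi
    have hsub : T ⊆ S := fun w hw => Finset.mem_of_mem_erase (Finset.mem_filter.mp (hTS hw)).1
    by_cases hij : j = i
    · subst hij
      have hvT : v ∉ T := fun h => by simpa using hTS h
      refine ⟨j, insert v T, Finset.insert_subset hv hsub, ?_, ?_⟩
      · have := hk j
        rw [Finset.card_insert_of_notMem hvT, hcard, Function.update_self]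
        omega
      · rw [Finset.coe_insert]
        refine hT.insert fun w hw _ => ?_
        have hvw := (Finset.mem_filter.mp (hTS hw)).2
        exact ⟨hvw, Sym2.eq_swap ▸ hvw⟩
    · exact ⟨j, T, hsub, by rw [hcard, Function.update_of_ne hij], hT⟩

/-- A monochromatic set of `a` vertices contains every graph on `a` vertices. -/
theorem contains_colorClass_of_pairwise {n m a : ℕ} {c : Sym2 (Fin n) → Fin m} {i : Fin m}
    (G : SimpleGraph (Fin a)) {T : Finset (Fin n)} (hcard : T.card = a)
    (hT : (T : Set (Fin n)).Pairwise fun x y => c s(x, y) = i) :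
    Contains (colorClass c i) G := by
  refine ⟨T.orderEmbOfFin hcard, (T.orderEmbOfFin hcard).injective, fun x y hxy => ?_⟩
  have hne := (T.orderEmbOfFin hcard).injective.ne hxy.ne
  simp only [colorClass, SimpleGraph.fromEdgeSet_adj, Set.mem_ofPred_eq]
  exact ⟨hT (T.orderEmbOfFin_mem hcard x) (T.orderEmbOfFin_mem hcard y) hne, hne⟩

theorem exists_not_goodColoring3 {a b d : ℕ} (G1 : SimpleGraph (Fin a))
    (G2 : SimpleGraph (Fin b)) (G3 : SimpleGraph (Fin d)) :
    ∃ n, ¬ GoodColoring3 G1 G2 G3 n := by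
  obtain ⟨N, hN⟩ := exists_card_forces_monochromatic ![a, b, d]
  refine ⟨N, fun ⟨c, h0, h1, h2⟩ => ?_⟩
  obtain ⟨i, T, -, hcard, hT⟩ := hN (Fin N) c Finset.univ (by simp)
  fin_cases i
  · exact h0 (contains_colorClass_of_pairwise G1 hcard hT)
  · exact h1 (contains_colorClass_of_pairwise G2 hcard hT)
  · exact h2 (contains_colorClass_of_pairwise G3 hcard hT)

theorem Contains.of_colorClass_comp {n n' m a : ℕ} {c : Sym2 (Fin n) → Fin m} {i : Fin m}
    {G : SimpleGraph (Fin a)} (g : Fin n' ↪ Fin n)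
    (h : Contains (colorClass (c ∘ Sym2.map g) i) G) : Contains (colorClass c i) G := by
  obtain ⟨f, hf, hadj⟩ := h
  refine ⟨g ∘ f, g.injective.comp hf, fun x y hxy => ?_⟩
  have hc := hadj hxy
  simp only [colorClass, SimpleGraph.fromEdgeSet_adj, Set.mem_ofPred_eq, Function.comp_apply,
    Sym2.map_mk] at hc ⊢
  exact ⟨hc.1, g.injective.ne hc.2⟩

theorem GoodColoring3.mono {a b d n n' : ℕ} {G1 : SimpleGraph (Fin a)}
    {G2 : SimpleGraph (Fin b)} {G3 : SimpleGraph (Fin d)} (hn : n' ≤ n)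
    (h : GoodColoring3 G1 G2 G3 n) : GoodColoring3 G1 G2 G3 n' := by
  obtain ⟨c, h0, h1, h2⟩ := h
  let g : Fin n' ↪ Fin n := Fin.castLEEmb hn
  exact ⟨c ∘ Sym2.map g, fun h => h0 (h.of_colorClass_comp g),
    fun h => h1 (h.of_colorClass_comp g), fun h => h2 (h.of_colorClass_comp g)⟩

theorem GoodColoring3.lt_ramsey3 {a b d n : ℕ} {G1 : SimpleGraph (Fin a)}
    {G2 : SimpleGraph (Fin b)} {G3 : SimpleGraph (Fin d)} (h : GoodColoring3 G1 G2 G3 n) :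
    n < Ramsey3 G1 G2 G3 := by
  have hmem : ¬ GoodColoring3 G1 G2 G3 (Ramsey3 G1 G2 G3) :=
    Nat.sInf_mem (exists_not_goodColoring3 G1 G2 G3)
  by_contra! hle
  exact hmem (h.mono hle)

/-- A symmetric matrix of colors on 20 vertices, built from two circulant blocks on
`{0, …, 9}` and `{10, …, 19}` and a circulant bipartite block between them. -/
def blockCirculant (x y : Fin 20) : Fin 3 :=
  let r := (y.val + 20 - x.val) % 10
  if x.val < 10 then
    if y.val < 10 then [0, 0, 1, 0, 2, 1, 2, 0, 1, 0].getD r 0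
    else [2, 0, 2, 2, 1, 1, 0, 1, 1, 2].getD r 0
  else
    if y.val < 10 then [2, 0, 2, 2, 1, 1, 0, 1, 1, 2].getD ((10 - r) % 10) 0
    else [0, 0, 2, 0, 1, 1, 1, 0, 2, 0].getD r 0

theorem blockCirculant_comm (x y : Fin 20) : blockCirculant x y = blockCirculant y x := by
  revert x y
  decide +kernel

/-- The edge coloring of `K₂₀` given by `blockCirculant`. -/
def blockColoring : Sym2 (Fin 20) → Fin 3 :=
  Sym2.lift ⟨blockCirculant, blockCirculant_comm⟩

theorem colorClass_blockColoring_adj {i : Fin 3} {x y : Fin 20} :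
    (colorClass blockColoring i).Adj x y ↔ blockCirculant x y = i ∧ x ≠ y := by
  simp [colorClass, blockColoring]

theorem blockCirculant_triangle_free (x y : Fin 20) (hxy : x ≠ y) (h : blockCirculant x y = 0)
    (z : Fin 20) (hxz : x ≠ z) (h' : blockCirculant x z = 0) (hyz : y ≠ z) :
    blockCirculant y z ≠ 0 := by
  revert x y
  revert z
  decide +kernel

/-- In each of the colors 1 and 2, two triangles sharing an edge coincide. -/
theorem blockCirculant_triangle_unique (i : Fin 3) (hi : i ≠ 0) (x y : Fin 20) (hxy : x ≠ y)
    (h : blockCirculant x y = i)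
    (z : Fin 20) (hxz : x ≠ z) (h₁ : blockCirculant x z = i)
    (hyz : y ≠ z) (h₂ : blockCirculant y z = i)
    (w : Fin 20) (hxw : x ≠ w) (h₃ : blockCirculant x w = i)
    (hyw : y ≠ w) (h₄ : blockCirculant y w = i) : z = w := by
  revert i x y z w
  decide +kernel

theorem not_contains_triangle_blockColoring :
    ¬ Contains (colorClass blockColoring 0) triangle := by
  rintro ⟨f, -, hadj⟩
  have key : ∀ a b : Fin 3, a ≠ b → blockCirculant (f a) (f b) = 0 ∧ f a ≠ f b := fun a b hab =>
    colorClass_blockColoring_adj.mp (hadj hab)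
  obtain ⟨h01, n01⟩ := key 0 1 (by decide)
  obtain ⟨h02, n02⟩ := key 0 2 (by decide)
  obtain ⟨h12, n12⟩ := key 1 2 (by decide)
  exact blockCirculant_triangle_free _ _ n01 h01 _ n02 h02 n12 h12

theorem not_contains_J4_blockColoring {i : Fin 3} (hi : i ≠ 0) :
    ¬ Contains (colorClass blockColoring i) J4 := by
  rintro ⟨f, hf, hadj⟩
  have key : ∀ a b : Fin 4, a ≠ b → s(a, b) ≠ s(0, 1) →
      blockCirculant (f a) (f b) = i ∧ f a ≠ f b := fun a b hab hne =>
    colorClass_blockColoring_adj.mp (hadj (by simpa [J4, hab] using hne))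
  obtain ⟨h23, n23⟩ := key 2 3 (by decide) (by decide)
  obtain ⟨h20, n20⟩ := key 2 0 (by decide) (by decide)
  obtain ⟨h30, n30⟩ := key 3 0 (by decide) (by decide)
  obtain ⟨h21, n21⟩ := key 2 1 (by decide) (by decide)
  obtain ⟨h31, n31⟩ := key 3 1 (by decide) (by decide)
  exact absurd (hf (blockCirculant_triangle_unique i hi _ _ n23 h23 _ n20 h20 n30 h30
    _ n21 h21 n31 h31)) (by decide)

/-- `R(K₃, K₄-e, K₄-e) ≥ 21`: there is a 3-coloring of the edges of `K₂₀` in which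
color 1 contains no triangle and colors 2 and 3 contain no `K₄ - e`. -/
theorem ramsey_K3_J4_J4_ge_21 :
    21 ≤ Ramsey3 triangle J4 J4 ∧ GoodColoring3 triangle J4 J4 20 := by
  have h : GoodColoring3 triangle J4 J4 20 :=
    ⟨blockColoring, not_contains_triangle_blockColoring,
      not_contains_J4_blockColoring (by decide), not_contains_J4_blockColoring (by decide)⟩
  exact ⟨h.lt_ramsey3, h⟩
end

section
/- R(K₃, K₄−e, K₄−e) ≤ 27. That is, every assignment of one of 3 colors to the edges of the complete graph K₂₇ yields a triangle K₃ in color 1 or a K₄−e in color 2 or in color 3. -/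
open SimpleGraph

namespace Ramsey27

/-- The colour of a pair of vertices, with `same` for a pair of equal vertices. -/
inductive Hue
  | same
  | red
  | blue
  | green
  deriving DecidableEq

namespace Hue

instance : Fintype Hue := ⟨{same, red, blue, green}, fun h => by cases h <;> simp⟩

/-- Exchange of the two `J₄`-free colours. -/
def swap : Hue → Hue
  | same => same
  | red => red
  | blue => green
  | green => blue

end Hue

open Hue

/-! ### The certificate

A function of the six hues of a quadruple `(x, y, z, w)` takes them in the order
`xy, xz, xw, yz, yw, zw`. -/

/-- A weighted square: for a pair `x, y` of hue `base`, the square of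
`∑ z, form (κ x z) (κ y z)`, multiplied by `weight`. -/
structure WeightedSquare where
  base : Hue
  weight : ℕ
  form : Hue → Hue → ℤ

namespace WeightedSquare

/-- The summand belonging to a quadruple in the expansion of a weighted square. -/
def eval (s : WeightedSquare) (xy xz yz xw yw : Hue) : ℤ :=
  if xy = s.base then s.weight * (s.form xz yz * s.form xw yw) else 0

/-- The weighted square with the colours `blue` and `green` exchanged. -/
def swap (s : WeightedSquare) : WeightedSquare where
  base := s.base.swap
  weight := s.weight
  form := fun p q => s.form p.swap q.swap

end WeightedSquare

/-- The form that counts, with coefficients `a`, `b`, `c`, the excess of one orientation over the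
other for the hue pairs red-blue, red-green and blue-green. -/
def oddForm (a b c : ℤ) : Hue → Hue → ℤ
  | red, blue => a
  | blue, red => -a
  | red, green => b
  | green, red => -b
  | blue, green => c
  | green, blue => -c
  | _, _ => 0

/-- The form comparing blue with green neighbours of a red edge. -/
def blueGreenForm : Hue → Hue → ℤ
  | blue, blue => 1
  | green, green => -1
  | red, blue => 3
  | blue, red => 3
  | red, green => -3
  | green, red => -3
  | _, _ => 0

/-- A form on the pairs of hues at a blue edge that is symmetric in the two end vertices. -/
def evenForm (k r b g rb rg : ℤ) : Hue → Hue → ℤ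
  | same, blue => k
  | red, red => r
  | blue, blue => b
  | green, green => g
  | red, blue => rb
  | blue, red => rb
  | red, green => rg
  | green, red => rg
  | _, _ => 0

/-- The weighted squares at red edges. -/
def redSquares : List WeightedSquare :=
  [⟨red, 9691, blueGreenForm⟩, ⟨red, 41229, oddForm 1 1 0⟩, ⟨red, 9606, oddForm 3 (-3) (-1)⟩]

/-- The weighted squares at blue edges. -/
def blueSquares : List WeightedSquare :=
  [⟨blue, 2446, oddForm 1 1 0⟩, ⟨blue, 1071, oddForm 3 (-3) (-1)⟩,
    ⟨blue, 249, oddForm 4 (-4) (-1)⟩, ⟨blue, 10135, evenForm 2 2 (-5) 0 (-1) 1⟩,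
    ⟨blue, 1292, evenForm 0 2 (-6) 0 (-1) 2⟩, ⟨blue, 2187, evenForm 0 0 6 (-1) 0 (-1)⟩]

/-- All weighted squares. -/
def squares : List WeightedSquare :=
  redSquares ++ blueSquares ++ blueSquares.map WeightedSquare.swap

/-- The multiplier of the identity `∑ w, (1 - 27 * [x = w]) = 0`. -/
def multiplier : Hue → Hue → Hue → ℤ
  | same, same, same => 1
  | same, red, red | red, same, red => 1
  | same, blue, blue | blue, same, blue | same, green, green | green, same, green => 782
  | red, red, same => 2
  | red, red, blue | red, red, green => 2923
  | red, blue, red | blue, red, red | red, green, red | green, red, red => 15103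
  | red, blue, blue | blue, red, blue | red, green, green | green, red, green => 281
  | red, blue, green | blue, red, green | red, green, blue | green, red, blue => 2276
  | blue, blue, same | green, green, same => 62
  | blue, blue, red | green, green, red => -1099
  | blue, blue, blue | green, green, green => 7400
  | blue, blue, green | green, green, blue => 159
  | blue, green, red | green, blue, red => 2169
  | blue, green, blue | green, blue, blue | green, blue, green | blue, green, green => 127
  | _, _, _ => 0

/-- The summand of the identity `∑ w, (1 - 27 * [x = w]) = 0` times its multiplier. -/
def balance (xy xz xw yz : Hue) : ℤ :=
  (if xw = same then -26 else 1) * multiplier xy xz yz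

/-- The summand of the inequality saying that an edge `xy` of colour `h` lies in at most one
triangle of colour `h`, applied once for every common red neighbour `z` of `x` and `y`. -/
def bookTerm (h xy xz xw yz yw : Hue) : ℤ :=
  if xy = h ∧ xz = red ∧ yz = red then
    (if xw = same then 1 else 0) - (if xw = h ∧ yw = h then 1 else 0)
  else 0

/-- The total certificate. -/
def certificate (xy xz xw yz yw _zw : Hue) : ℤ :=
  (squares.map fun s => s.eval xy xz yz xw yw).sum +
    (236659 * (bookTerm blue xy xz xw yz yw + bookTerm green xy xz xw yz yw) +
      balance xy xz xw yz)

/-! ### Symmetrization -/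

/-- Functions of the six hues of a quadruple. -/
abbrev HueFun := Hue → Hue → Hue → Hue → Hue → Hue → ℤ

/-- Exchange of the first two vertices. -/
def HueFun.swapXY (F : HueFun) : HueFun := fun xy xz xw yz yw zw => F xy yz yw xz xw zw

/-- Exchange of the second and third vertices. -/
def HueFun.swapYZ (F : HueFun) : HueFun := fun xy xz xw yz yw zw => F xz xy xw yz zw yw

/-- Exchange of the last two vertices. -/
def HueFun.swapZW (F : HueFun) : HueFun := fun xy xz xw yz yw zw => F xy xw xz yw yz zw

/-- Sum over the exchange of the first two vertices. -/
def HueFun.sym₂ (F : HueFun) : HueFun := F + F.swapXY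

/-- Sum over all permutations of the first three vertices. -/
def HueFun.sym₃ (F : HueFun) : HueFun := F.sym₂ + F.sym₂.swapYZ + F.sym₂.swapYZ.swapXY

/-- Sum over all permutations of the four vertices. -/
def HueFun.sym₄ (F : HueFun) : HueFun :=
  F.sym₃ + F.sym₃.swapZW + F.sym₃.swapZW.swapYZ + F.sym₃.swapZW.swapYZ.swapXY

/-- The conditions on the hues of a triple: equality is transitive and there is no red triangle. -/
def triangleOk (a b c : Hue) : Bool :=
  (a != same || b == c) && (b != same || a == c) && (c != same || a == b) &&
    !(a == red && b == red && c == red)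

/-- `e` and the five other hues do not form a `J₄` of hue `h` with missing pair `e`. -/
def bookOk (h e a b c d f : Hue) : Bool :=
  !(e != same && a == h && b == h && c == h && d == h && f == h)

/-- No four vertices of the quadruple span a `J₄` of hue `h`. -/
def quadrupleOk (h xy xz xw yz yw zw : Hue) : Bool :=
  bookOk h xy xz xw yz yw zw && bookOk h xz xy xw yz yw zw && bookOk h xw xy xz yz yw zw &&
    bookOk h yz xy xz xw yw zw && bookOk h yw xy xz xw yz zw && bookOk h zw xy xz xw yz yw

/-- All conditions on the hues of a quadruple. -/
def admissible (xy xz xw yz yw zw : Hue) : Bool :=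
  triangleOk xy xz yz && triangleOk xy xw yw && triangleOk xz xw zw && triangleOk yz yw zw &&
    (quadrupleOk blue xy xz xw yz yw zw && quadrupleOk green xy xz xw yz yw zw)

theorem certificate_sym₄_neg :
    ∀ xy xz xw yz yw zw, admissible xy xz xw yz yw zw = true →
      HueFun.sym₄ certificate xy xz xw yz yw zw < 0 := by
  decide +kernel

/-! ### Summation over quadruples -/

section Sums

variable {V : Type*} [Fintype V]

/-- The sum of `F` over all quadruples of vertices, for the hues given by `κ`. -/
def total (κ : V → V → Hue) (F : HueFun) : ℤ :=
  ∑ x, ∑ y, ∑ z, ∑ w, F (κ x y) (κ x z) (κ x w) (κ y z) (κ y w) (κ z w)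

variable {κ : V → V → Hue}

theorem total_add (F G : HueFun) : total κ (F + G) = total κ F + total κ G := by
  simp only [total, Pi.add_apply, Finset.sum_add_distrib]

theorem total_swapXY (symm : ∀ x y, κ x y = κ y x) (F : HueFun) :
    total κ F.swapXY = total κ F := by
  unfold total HueFun.swapXY
  rw [Finset.sum_comm]
  refine Finset.sum_congr rfl fun y _ => Finset.sum_congr rfl fun x _ => ?_
  simp only [symm x y]

theorem total_swapYZ (symm : ∀ x y, κ x y = κ y x) (F : HueFun) :
    total κ F.swapYZ = total κ F := by
  unfold total HueFun.swapYZ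
  refine Finset.sum_congr rfl fun x _ => ?_
  rw [Finset.sum_comm]
  refine Finset.sum_congr rfl fun z _ => Finset.sum_congr rfl fun y _ => ?_
  simp only [symm y z]

theorem total_swapZW (symm : ∀ x y, κ x y = κ y x) (F : HueFun) :
    total κ F.swapZW = total κ F := by
  unfold total HueFun.swapZW
  refine Finset.sum_congr rfl fun x _ => Finset.sum_congr rfl fun y _ => ?_
  rw [Finset.sum_comm]
  refine Finset.sum_congr rfl fun w _ => Finset.sum_congr rfl fun z _ => ?_
  simp only [symm z w]

theorem total_sym₄ (symm : ∀ x y, κ x y = κ y x) (F : HueFun) :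
    total κ F.sym₄ = 24 * total κ F := by
  simp only [HueFun.sym₄, HueFun.sym₃, HueFun.sym₂, total_add, total_swapXY symm,
    total_swapYZ symm, total_swapZW symm]
  ring

theorem WeightedSquare.sum_eval_nonneg (s : WeightedSquare) (κ : V → V → Hue) (x y : V) :
    0 ≤ ∑ z, ∑ w, s.eval (κ x y) (κ x z) (κ y z) (κ x w) (κ y w) := by
  unfold WeightedSquare.eval
  split_ifs
  · simp only [← Finset.mul_sum, ← Finset.sum_mul]
    exact mul_nonneg (Int.natCast_nonneg _) (mul_self_nonneg _)
  · simp

theorem sum_squares_nonneg (L : List WeightedSquare) (κ : V → V → Hue) (x y : V) :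
    0 ≤ ∑ z, ∑ w, (L.map fun s => s.eval (κ x y) (κ x z) (κ y z) (κ x w) (κ y w)).sum := by
  induction L with
  | nil => simp
  | cons s L ih =>
    simp only [List.map_cons, List.sum_cons, Finset.sum_add_distrib]
    exact add_nonneg (s.sum_eval_nonneg κ x y) ih

variable [DecidableEq V]

theorem sum_ite_same (eq_iff : ∀ x y, κ x y = same ↔ x = y) (x : V) (a : ℤ) :
    ∑ w, (if κ x w = same then a else 0) = a := by
  simp [eq_iff]

theorem sum_balance (eq_iff : ∀ x y, κ x y = same ↔ x = y) (card : Fintype.card V = 27)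
    (x y z : V) : ∑ w, balance (κ x y) (κ x z) (κ x w) (κ y z) = 0 := by
  have h : ∀ w, (if κ x w = same then (-26 : ℤ) else 1) =
      1 + if κ x w = same then -27 else 0 := fun w => by split_ifs <;> rfl
  simp only [balance, ← Finset.sum_mul, h, Finset.sum_add_distrib, sum_ite_same eq_iff]
  simp [card]

theorem sum_bookTerm_nonneg (eq_iff : ∀ x y, κ x y = same ↔ x = y) {h : Hue}
    (book : ∀ x y z w, κ x y = h → κ x z = h → κ y z = h → κ x w = h → κ y w = h → z = w)
    (x y z : V) : 0 ≤ ∑ w, bookTerm h (κ x y) (κ x z) (κ x w) (κ y z) (κ y w) := by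
  unfold bookTerm
  split_ifs with hxy
  · rw [Finset.sum_sub_distrib, sum_ite_same eq_iff, sub_nonneg, Finset.sum_boole]
    refine mod_cast Finset.card_le_one.2 fun a ha b hb => ?_
    simp only [Finset.mem_filter, Finset.mem_univ, true_and] at ha hb
    exact book x y a b hxy.1 ha.1 ha.2 hb.1 hb.2
  · simp

theorem total_certificate_nonneg (eq_iff : ∀ x y, κ x y = same ↔ x = y)
    (card : Fintype.card V = 27)
    (book : ∀ h, h = blue ∨ h = green → ∀ x y z w,
      κ x y = h → κ x z = h → κ y z = h → κ x w = h → κ y w = h → z = w) :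
    0 ≤ total κ certificate := by
  unfold total certificate
  refine Finset.sum_nonneg fun x _ => Finset.sum_nonneg fun y _ => ?_
  simp only [Finset.sum_add_distrib, ← Finset.mul_sum, sum_balance eq_iff card]
  have hb : 0 ≤ ∑ z, ∑ w, bookTerm blue (κ x y) (κ x z) (κ x w) (κ y z) (κ y w) :=
    Finset.sum_nonneg fun z _ => sum_bookTerm_nonneg eq_iff (book blue (.inl rfl)) x y z
  have hg : 0 ≤ ∑ z, ∑ w, bookTerm green (κ x y) (κ x z) (κ x w) (κ y z) (κ y w) :=
    Finset.sum_nonneg fun z _ => sum_bookTerm_nonneg eq_iff (book green (.inr rfl)) x y z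
  have hs := sum_squares_nonneg squares κ x y
  simp only [Finset.sum_const_zero]
  positivity

end Sums

section Hueing

variable {V : Type*} {κ : V → V → Hue}

theorem triangleOk_of_hueing (symm : ∀ x y, κ x y = κ y x) (eq_iff : ∀ x y, κ x y = same ↔ x = y)
    (no_triangle : ∀ x y z, ¬ (κ x y = red ∧ κ x z = red ∧ κ y z = red)) (x y z : V) :
    triangleOk (κ x y) (κ x z) (κ y z) = true := by
  have hxy : κ x y = same → κ x z = κ y z := fun h => by rw [(eq_iff x y).1 h]
  have hxz : κ x z = same → κ x y = κ y z := fun h => by rw [(eq_iff x z).1 h, symm]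
  have hyz : κ y z = same → κ x y = κ x z := fun h => by rw [(eq_iff y z).1 h]
  have hr := no_triangle x y z
  simp only [triangleOk, Bool.and_eq_true, Bool.or_eq_true, bne_iff_ne, beq_iff_eq,
    Bool.not_eq_true', ← Bool.not_eq_true]
  tauto

theorem bookOk_iff {h e a b c d f : Hue} :
    bookOk h e a b c d f = true ↔ (a = h → b = h → c = h → d = h → f = h → e = same) := by
  simp only [bookOk, Bool.not_eq_true', ← Bool.not_eq_true, Bool.and_eq_true, bne_iff_ne,
    beq_iff_eq]
  refine ⟨fun H ha hb hc hd hf => ?_, fun H he => ?_⟩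
  · by_contra he
    exact H ⟨⟨⟨⟨⟨he, ha⟩, hb⟩, hc⟩, hd⟩, hf⟩
  · obtain ⟨⟨⟨⟨⟨he, ha⟩, hb⟩, hc⟩, hd⟩, hf⟩ := he
    exact he (H ha hb hc hd hf)

theorem quadrupleOk_of_hueing (symm : ∀ x y, κ x y = κ y x) (eq_iff : ∀ x y, κ x y = same ↔ x = y)
    {h : Hue}
    (book : ∀ x y z w, κ x y = h → κ x z = h → κ y z = h → κ x w = h → κ y w = h → z = w)
    (x y z w : V) : quadrupleOk h (κ x y) (κ x z) (κ x w) (κ y z) (κ y w) (κ z w) = true := by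
  have key : ∀ x y z w : V, κ x y = h → κ x z = h → κ y z = h → κ x w = h → κ y w = h →
      κ z w = same := fun x y z w h1 h2 h3 h4 h5 => (eq_iff z w).2 (book x y z w h1 h2 h3 h4 h5)
  have flip : ∀ {x y : V}, κ x y = h → κ y x = h := fun e => (symm _ _).trans e
  simp only [quadrupleOk, Bool.and_eq_true, bookOk_iff]
  refine ⟨⟨⟨⟨⟨?_, ?_⟩, ?_⟩, ?_⟩, ?_⟩, ?_⟩
  · exact fun xz xw yz yw zw => key z w x y zw (flip xz) (flip xw) (flip yz) (flip yw)
  · exact fun xy xw yz yw zw => key y w x z yw (flip xy) (flip xw) yz (flip zw)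
  · exact fun xy xz yz yw zw => key y z x w yz (flip xy) (flip xz) yw zw
  · exact fun xy xz xw yw zw => key x w y z xw xy (flip yw) xz (flip zw)
  · exact fun xy xz xw yz zw => key x z y w xz xy (flip yz) xw zw
  · exact fun xy xz xw yz yw => key x y z w xy xz yz xw yw

/-- There is no colouring of the pairs of 27 vertices without red triangle and without blue or
green `J₄`. -/
theorem no_hueing [Fintype V] [DecidableEq V] (card : Fintype.card V = 27)
    (symm : ∀ x y, κ x y = κ y x) (eq_iff : ∀ x y, κ x y = same ↔ x = y)
    (no_triangle : ∀ x y z, ¬ (κ x y = red ∧ κ x z = red ∧ κ y z = red))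
    (book : ∀ h, h = blue ∨ h = green → ∀ x y z w,
      κ x y = h → κ x z = h → κ y z = h → κ x w = h → κ y w = h → z = w) : False := by
  have : Nonempty V := Fintype.card_pos_iff.1 (by omega)
  have nonneg := total_certificate_nonneg eq_iff card book
  have neg : total κ (HueFun.sym₄ certificate) < 0 := by
    have tri := triangleOk_of_hueing symm eq_iff no_triangle
    have quad := fun h hh => quadrupleOk_of_hueing symm eq_iff (book h hh)
    refine Finset.sum_neg (fun x _ => Finset.sum_neg (fun y _ => Finset.sum_neg (fun z _ =>
      Finset.sum_neg (fun w _ => certificate_sym₄_neg _ _ _ _ _ _ ?_) ?_) ?_) ?_) ?_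
    any_goals exact Finset.univ_nonempty
    simp [admissible, tri, quad]
  rw [total_sym₄ symm] at neg
  omega

end Hueing

end Ramsey27

theorem contains_triangle_s13 {V : Type*} {G : SimpleGraph V} {x y z : V} (hxy : G.Adj x y)
    (hxz : G.Adj x z) (hyz : G.Adj y z) : Contains G triangle := by
  have hadj : ∀ ⦃a b : Fin 3⦄, triangle.Adj a b → G.Adj (![x, y, z] a) (![x, y, z] b) := by
    intro a b hab
    fin_cases a <;> fin_cases b <;> simp_all [triangle, G.adj_comm]
  refine ⟨![x, y, z], fun a b hab => ?_, hadj⟩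
  by_contra hne
  exact (hadj hne).ne hab

theorem contains_J4_s13 {V : Type*} {G : SimpleGraph V} {x y z w : V} (hzw : z ≠ w)
    (hxy : G.Adj x y) (hxz : G.Adj x z) (hyz : G.Adj y z) (hxw : G.Adj x w) (hyw : G.Adj y w) :
    Contains G J4 := by
  refine ⟨![z, w, x, y], fun a b hab => ?_, fun a b hab => ?_⟩
  · have := hxy.ne
    have := hxz.ne
    have := hyz.ne
    have := hxw.ne
    have := hyw.ne
    fin_cases a <;> fin_cases b <;> simp_all
  · fin_cases a <;> fin_cases b <;> simp_all [J4, G.adj_comm]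

open Ramsey27 in
theorem not_goodColoring3_triangle_J4_J4_27 : ¬ GoodColoring3 triangle J4 J4 27 := by
  rintro ⟨c, h0, h1, h2⟩
  let hue : Fin 3 → Hue := ![.red, .blue, .green]
  let κ : Fin 27 → Fin 27 → Hue := fun x y => if x = y then .same else hue (c s(x, y))
  have hue_inj : Function.Injective hue := by decide
  have hue_ne : ∀ i, hue i ≠ .same := by decide
  have eq_iff : ∀ x y, κ x y = .same ↔ x = y := fun x y => by simp [κ, hue_ne]
  have adj : ∀ i x y, κ x y = hue i → (colorClass c i).Adj x y := fun i x y h => by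
    have hne : x ≠ y := fun e => hue_ne i (h.symm.trans ((eq_iff x y).2 e))
    simp only [κ, if_neg hne] at h
    simpa [colorClass] using ⟨hue_inj h, hne⟩
  have symm : ∀ x y, κ x y = κ y x := fun x y => by simp only [κ, Sym2.eq_swap, eq_comm]
  have book : ∀ i, ¬ Contains (colorClass c i) J4 → ∀ x y z w, κ x y = hue i → κ x z = hue i →
      κ y z = hue i → κ x w = hue i → κ y w = hue i → z = w := by
    intro i hi x y z w hxy hxz hyz hxw hyw
    by_contra hzw
    refine hi (contains_J4_s13 hzw (adj i x y hxy) (adj i x z hxz) (adj i y z hyz) (adj i x w hxw)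
      (adj i y w hyw))
  refine no_hueing (κ := κ) (by simp) symm eq_iff ?_ ?_
  · rintro x y z ⟨hxy, hxz, hyz⟩
    exact h0 (contains_triangle_s13 (adj 0 x y hxy) (adj 0 x z hxz) (adj 0 y z hyz))
  · rintro h (rfl | rfl)
    · exact book 1 h1
    · exact book 2 h2

/-- `R(K₃, K₄-e, K₄-e) ≤ 27`: every 3-coloring of the edges of `K₂₇` yields a triangle
in color 1 or a `K₄ - e` in color 2 or in color 3. -/
theorem ramsey_K3_J4_J4_le_27 :
    Ramsey3 triangle J4 J4 ≤ 27 ∧ ¬ GoodColoring3 triangle J4 J4 27 :=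
  ⟨Nat.sInf_le not_goodColoring3_triangle_J4_J4_27, not_goodColoring3_triangle_J4_J4_27⟩
end
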